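/- Let (X,M,*) be a fuzzy metric space such that the set X' of all accumulation points of (X,τ_M) is compact and, for every δ₁ ∈ (0,1) and t₁ > 0, there exist δ₂ ∈ (0,1) and t₂ > 0 such that every x ∈ X with sup_{a∈X'} M(x,a,t₁) ≤ 1−δ₁ satisfies sup_{y≠x} M(x,y,t₂) ≤ 1−δ₂. Then (X,M,*) is Lebesgue. -/

import Mathlib

open Filter Topology Set

/-- A fuzzy metric space in the sense of George and Veeramani: a continuous
t-norm `star` on `[0,1]` together with a fuzzy set `M` on `X × X × (0,∞)`. -/
structure FuzzyMetric (X : Type*) where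
  M : X → X → ℝ → ℝ
  star : ℝ → ℝ → ℝ
  star_mem : ∀ a ∈ Set.Icc (0:ℝ) 1, ∀ b ∈ Set.Icc (0:ℝ) 1, star a b ∈ Set.Icc (0:ℝ) 1
  star_comm : ∀ a ∈ Set.Icc (0:ℝ) 1, ∀ b ∈ Set.Icc (0:ℝ) 1, star a b = star b a
  star_assoc : ∀ a ∈ Set.Icc (0:ℝ) 1, ∀ b ∈ Set.Icc (0:ℝ) 1, ∀ c ∈ Set.Icc (0:ℝ) 1,
    star (star a b) c = star a (star b c)
  star_one : ∀ a ∈ Set.Icc (0:ℝ) 1, star a 1 = a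
  star_mono : ∀ a b c d : ℝ, a ∈ Set.Icc (0:ℝ) 1 → b ∈ Set.Icc (0:ℝ) 1 →
    c ∈ Set.Icc (0:ℝ) 1 → d ∈ Set.Icc (0:ℝ) 1 → a ≤ b → c ≤ d → star a c ≤ star b d
  star_continuous : ContinuousOn (fun p : ℝ × ℝ => star p.1 p.2)
    (Set.Icc (0:ℝ) 1 ×ˢ Set.Icc (0:ℝ) 1)
  M_pos : ∀ x y t, 0 < t → 0 < M x y t
  M_le_one : ∀ x y t, 0 < t → M x y t ≤ 1
  M_eq_one_iff : ∀ x y t, 0 < t → (M x y t = 1 ↔ x = y)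
  M_symm : ∀ x y t, 0 < t → M x y t = M y x t
  M_triangle : ∀ x y z t s, 0 < t → 0 < s → star (M x y t) (M y z s) ≤ M x z (t + s)
  M_continuousOn : ∀ x y, ContinuousOn (M x y) (Set.Ioi (0:ℝ))

namespace FuzzyMetric

variable {X : Type*}

/-- The open ball `B(x,r,t)`. -/
def ball (F : FuzzyMetric X) (x : X) (r t : ℝ) : Set X := {y | 1 - r < F.M x y t}

/-- The topology `τ_M` induced by the fuzzy metric (the balls form a base for it). -/
def topology (F : FuzzyMetric X) : TopologicalSpace X :=
  TopologicalSpace.generateFrom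
    {s | ∃ x : X, ∃ r t : ℝ, r ∈ Set.Ioo (0:ℝ) 1 ∧ 0 < t ∧ s = F.ball x r t}

/-- `f : X → ℝ` is `ℝ`-uniformly continuous. -/
def RUniformlyContinuous (F : FuzzyMetric X) (f : X → ℝ) : Prop :=
  ∀ ε > (0:ℝ), ∃ r ∈ Set.Ioo (0:ℝ) 1, ∃ s > (0:ℝ),
    ∀ x y : X, 1 - r < F.M x y s → |f x - f y| < ε

/-- The Lebesgue property: every open cover is refined by the family of balls of
some fixed radius `r` and parameter `t`. -/
def Lebesgue (F : FuzzyMetric X) : Prop :=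
  ∀ 𝒢 : Set (Set X), (∀ G ∈ 𝒢, F.topology.IsOpen G) → ⋃₀ 𝒢 = Set.univ →
    ∃ r ∈ Set.Ioo (0:ℝ) 1, ∃ t > (0:ℝ), ∀ x : X, ∃ G ∈ 𝒢, F.ball x r t ⊆ G

/-- A set `A ⊆ X` is fuzzy uniformly discrete. -/
def UniformlyDiscrete (F : FuzzyMetric X) (A : Set X) : Prop :=
  ∃ r ∈ Set.Ioo (0:ℝ) 1, ∃ s > (0:ℝ), ∀ x ∈ A, ∀ y ∈ A, x ≠ y → F.M x y s < 1 - r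

/-- The set `X'` of accumulation points of `(X, τ_M)`. -/
def derivedSet (F : FuzzyMetric X) : Set X :=
  {x | ∀ U : Set X, F.topology.IsOpen U → x ∈ U → ∃ y ∈ U, y ≠ x}

/-- A sequence is Cauchy in the fuzzy metric. -/
def IsCauchy (F : FuzzyMetric X) (u : ℕ → X) : Prop :=
  ∀ ε ∈ Set.Ioo (0:ℝ) 1, ∀ t > (0:ℝ), ∃ k : ℕ, ∀ m ≥ k, ∀ n ≥ k, 1 - ε < F.M (u m) (u n) t

/-- Sequential compactness: every sequence has a convergent subsequence. -/
def SeqCompact (F : FuzzyMetric X) : Prop :=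
  ∀ u : ℕ → X, ∃ x : X, ∃ φ : ℕ → ℕ, StrictMono φ ∧
    Filter.Tendsto (u ∘ φ) Filter.atTop (@nhds X F.topology x)

end FuzzyMetric

namespace FuzzyMetric

variable {X : Type*} (F : FuzzyMetric X)

lemma M_self (x : X) {t : ℝ} (ht : 0 < t) : F.M x x t = 1 :=
  (F.M_eq_one_iff x x t ht).2 rfl

lemma M_mem_Icc (x y : X) {t : ℝ} (ht : 0 < t) : F.M x y t ∈ Set.Icc (0:ℝ) 1 :=
  ⟨(F.M_pos x y t ht).le, F.M_le_one x y t ht⟩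

lemma M_mono (x y : X) {s t : ℝ} (hs : 0 < s) (hst : s ≤ t) : F.M x y s ≤ F.M x y t := by
  rcases hst.eq_or_lt with rfl | hlt
  · exact le_rfl
  · have h := F.M_triangle x y y s (t - s) hs (sub_pos.2 hlt)
    rwa [F.M_self y (sub_pos.2 hlt), F.star_one _ (F.M_mem_Icc x y hs), add_sub_cancel] at h

lemma ball_subset_ball (x : X) {r r' s t : ℝ} (hr : r ≤ r') (hs : 0 < s) (hst : s ≤ t) :
    F.ball x r s ⊆ F.ball x r' t := by
  intro y hy
  have h := F.M_mono x y hs hst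
  simp only [ball, Set.mem_ofPred_eq] at hy ⊢
  linarith

lemma mem_ball_self (x : X) {r t : ℝ} (hr : 0 < r) (ht : 0 < t) : x ∈ F.ball x r t := by
  simp only [ball, Set.mem_ofPred_eq, F.M_self x ht]
  linarith

/-- Values of the t-norm close to `(c, 1)` exceed any number below `c`. -/
lemma exists_lt_star {b c : ℝ} (hc : c ∈ Set.Icc (0:ℝ) 1) (hbc : b < c) :
    ∃ s ∈ Set.Ioo (0:ℝ) 1, ∀ u ∈ Set.Icc (0:ℝ) 1, ∀ v ∈ Set.Icc (0:ℝ) 1,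
      c - s < u → 1 - s < v → b < F.star u v := by
  have hone : (1:ℝ) ∈ Set.Icc (0:ℝ) 1 := ⟨zero_le_one, le_rfl⟩
  have hcont := F.star_continuous (c, 1) ⟨hc, hone⟩
  have hlim : F.star c 1 = c := F.star_one c hc
  obtain ⟨δ, hδ, h⟩ := Metric.continuousWithinAt_iff.1 hcont (c - b) (sub_pos.2 hbc)
  refine ⟨min (δ / 2) (1 / 2), ⟨by positivity, by linarith [min_le_right (δ / 2) (1 / 2 : ℝ)]⟩, ?_⟩
  intro u hu v hv hu' hv'
  have hsδ : min (δ / 2) (1 / 2) ≤ δ / 2 := min_le_left _ _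
  have hw : min u c ∈ Set.Icc (0:ℝ) 1 := ⟨le_min hu.1 hc.1, (min_le_left _ _).trans hu.2⟩
  have hd : dist (min u c, v) (c, (1:ℝ)) < δ := by
    rw [Prod.dist_eq, max_lt_iff, Real.dist_eq, Real.dist_eq, abs_lt, abs_lt]
    have h1 : c - δ < min u c := lt_min (by linarith) (by linarith)
    have h2 : min u c ≤ c := min_le_right _ _
    exact ⟨⟨by linarith, by linarith⟩, by linarith, by linarith [hv.2]⟩
  have hclose := h (Set.mk_mem_prod hw hv) hd
  simp only [hlim, Real.dist_eq, abs_lt] at hclose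
  have hmono := F.star_mono _ _ _ _ hw hu hv hv (min_le_left u c) le_rfl
  linarith [hclose.1]

lemma exists_lt_M_of_lt_of_lt {r t : ℝ} (hr : 0 < r) (ht : 0 < t) :
    ∃ s ∈ Set.Ioo (0:ℝ) 1, ∃ t' > (0:ℝ), ∀ x y z : X,
      1 - s < F.M x y t' → 1 - s < F.M y z t' → 1 - r < F.M x z t := by
  obtain ⟨s, hs, h⟩ := F.exists_lt_star (b := 1 - r) (c := 1) ⟨zero_le_one, le_rfl⟩ (by linarith)
  refine ⟨s, hs, t / 2, half_pos ht, fun x y z hxy hyz => ?_⟩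
  have htri := F.M_triangle x y z _ _ (half_pos ht) (half_pos ht)
  rw [add_halves] at htri
  exact (h _ (F.M_mem_Icc x y (half_pos ht)) _ (F.M_mem_Icc y z (half_pos ht)) hxy hyz).trans_le
    htri

lemma exists_ball_subset_ball {x y : X} {r t : ℝ} (ht : 0 < t) (hy : y ∈ F.ball x r t) :
    ∃ s ∈ Set.Ioo (0:ℝ) 1, ∃ t' > (0:ℝ), F.ball y s t' ⊆ F.ball x r t := by
  have hcont : ContinuousAt (F.M x y) t := (F.M_continuousOn x y).continuousAt (Ioi_mem_nhds ht)
  have hev : ∀ᶠ u in 𝓝[<] t, 1 - r < F.M x y u ∧ u ∈ Set.Ioo 0 t :=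
    ((hcont.eventually_const_lt hy).filter_mono nhdsWithin_le_nhds).and (Ioo_mem_nhdsLT ht)
  obtain ⟨u, hu, hu0, hut⟩ := hev.exists
  obtain ⟨s, hs, h⟩ := F.exists_lt_star (F.M_mem_Icc x y hu0) hu
  refine ⟨s, hs, t - u, sub_pos.2 hut, fun z hz => ?_⟩
  have htri := F.M_triangle x y z u (t - u) hu0 (sub_pos.2 hut)
  rw [add_sub_cancel] at htri
  exact (h _ (F.M_mem_Icc x y hu0) _ (F.M_mem_Icc y z (sub_pos.2 hut))
    (by linarith [hs.1]) hz).trans_le htri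

lemma exists_ball_subset_of_isOpen {G : Set X} (hG : F.topology.IsOpen G) {x : X} (hx : x ∈ G) :
    ∃ r ∈ Set.Ioo (0:ℝ) 1, ∃ t > (0:ℝ), F.ball x r t ⊆ G := by
  change TopologicalSpace.GenerateOpen _ G at hG
  induction hG with
  | basic s hs =>
    obtain ⟨y, r, t, -, ht, rfl⟩ := hs
    exact F.exists_ball_subset_ball ht hx
  | univ => exact ⟨1 / 2, by norm_num, 1, one_pos, Set.subset_univ _⟩
  | inter U V _ _ ihU ihV =>
    obtain ⟨r, hr, t, ht, h⟩ := ihU hx.1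
    obtain ⟨r', hr', t', ht', h'⟩ := ihV hx.2
    exact ⟨min r r', ⟨lt_min hr.1 hr'.1, (min_le_left _ _).trans_lt hr.2⟩, min t t',
      lt_min ht ht', Set.subset_inter
        ((F.ball_subset_ball x (min_le_left _ _) (lt_min ht ht') (min_le_left _ _)).trans h)
        ((F.ball_subset_ball x (min_le_right _ _) (lt_min ht ht') (min_le_right _ _)).trans h')⟩
  | sUnion S _ ih =>
    obtain ⟨U, hU, hxU⟩ := hx
    obtain ⟨r, hr, t, ht, h⟩ := ih U hU hxU
    exact ⟨r, hr, t, ht, h.trans (Set.subset_sUnion_of_mem hU)⟩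

lemma isOpen_ball (x : X) {r t : ℝ} (hr : r ∈ Set.Ioo (0:ℝ) 1) (ht : 0 < t) :
    F.topology.IsOpen (F.ball x r t) :=
  TopologicalSpace.GenerateOpen.basic _ ⟨x, r, t, hr, ht, rfl⟩

/-- A Lebesgue number for an open cover of a compact set, valid near that set. -/
lemma exists_ball_subset_of_isCompact {K : Set X} (hK : @IsCompact X F.topology K)
    {𝒢 : Set (Set X)} (hopen : ∀ G ∈ 𝒢, F.topology.IsOpen G) (hcover : K ⊆ ⋃₀ 𝒢) :
    ∃ r ∈ Set.Ioo (0:ℝ) 1, ∃ t > (0:ℝ), ∀ a ∈ K, ∀ x : X, 1 - r < F.M x a t →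
      ∃ G ∈ 𝒢, F.ball x r t ⊆ G := by
  let := F.topology
  refine hK.induction_on (p := fun S => ∃ r ∈ Set.Ioo (0:ℝ) 1, ∃ t > (0:ℝ), ∀ a ∈ S, ∀ x : X,
    1 - r < F.M x a t → ∃ G ∈ 𝒢, F.ball x r t ⊆ G) ?_ ?_ ?_ ?_
  · exact ⟨1 / 2, by norm_num, 1, one_pos, fun a ha => ha.elim⟩
  · rintro S T hST ⟨r, hr, t, ht, h⟩
    exact ⟨r, hr, t, ht, fun a ha => h a (hST ha)⟩
  · rintro S T ⟨r, hr, t, ht, h⟩ ⟨r', hr', t', ht', h'⟩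
    have hm : 0 < min t t' := lt_min ht ht'
    refine ⟨min r r', ⟨lt_min hr.1 hr'.1, (min_le_left _ _).trans_lt hr.2⟩, min t t', hm, ?_⟩
    rintro a (ha | ha) x hx
    · have hsub := F.ball_subset_ball x (min_le_left r r') hm (min_le_left t t')
      obtain ⟨G, hG, hGs⟩ := h a ha x (hsub hx)
      exact ⟨G, hG, hsub.trans hGs⟩
    · have hsub := F.ball_subset_ball x (min_le_right r r') hm (min_le_right t t')
      obtain ⟨G, hG, hGs⟩ := h' a ha x (hsub hx)
      exact ⟨G, hG, hsub.trans hGs⟩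
  · intro a ha
    obtain ⟨G, hG, haG⟩ := hcover ha
    obtain ⟨r, hr, t, ht, hball⟩ := F.exists_ball_subset_of_isOpen (hopen G hG) haG
    obtain ⟨r₁, hr₁, t₁, ht₁, h₁⟩ := F.exists_lt_M_of_lt_of_lt hr.1 ht
    obtain ⟨r₂, hr₂, t₂, ht₂, h₂⟩ := F.exists_lt_M_of_lt_of_lt hr₁.1 ht₁
    refine ⟨F.ball a r₁ t₁, mem_nhdsWithin_of_mem_nhds
      (IsOpen.mem_nhds (F.isOpen_ball a hr₁ ht₁) (F.mem_ball_self a hr₁.1 ht₁)),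
      r₂, hr₂, t₂, ht₂, fun b hb x hx => ⟨G, hG, fun y hy => hball ?_⟩⟩
    rw [F.M_symm x b t₂ ht₂] at hx
    exact h₁ a b y hb (h₂ b x y hx hy)

end FuzzyMetric

/-- If `X'` is compact and points far from `X'` are uniformly isolated, then `(X,M,*)`
is Lebesgue. -/
theorem lebesgue_of_derivedSet_compact_isolation {X : Type*} [Nonempty X] (F : FuzzyMetric X)
    (hc : @IsCompact X F.topology F.derivedSet)
    (hiso : ∀ δ₁ ∈ Set.Ioo (0:ℝ) 1, ∀ t₁ > (0:ℝ), ∃ δ₂ ∈ Set.Ioo (0:ℝ) 1, ∃ t₂ > (0:ℝ),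
      ∀ x : X, (∀ a ∈ F.derivedSet, F.M x a t₁ ≤ 1 - δ₁) →
        ∀ y : X, y ≠ x → F.M x y t₂ ≤ 1 - δ₂) :
    F.Lebesgue := by
  intro 𝒢 hopen hcover
  obtain ⟨r₁, hr₁, t₁, ht₁, h₁⟩ :=
    F.exists_ball_subset_of_isCompact hc hopen (hcover ▸ Set.subset_univ _)
  obtain ⟨r₂, hr₂, t₂, ht₂, h₂⟩ := hiso r₁ hr₁ t₁ ht₁
  have hm : 0 < min t₁ t₂ := lt_min ht₁ ht₂
  refine ⟨min r₁ r₂, ⟨lt_min hr₁.1 hr₂.1, (min_le_left _ _).trans_lt hr₁.2⟩, min t₁ t₂, hm,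
    fun x => ?_⟩
  by_cases hx : ∀ a ∈ F.derivedSet, F.M x a t₁ ≤ 1 - r₁
  · obtain ⟨G, hG, hxG⟩ : x ∈ ⋃₀ 𝒢 := hcover ▸ Set.mem_univ x
    refine ⟨G, hG, fun y hy => ?_⟩
    have hy' : y ∈ F.ball x r₂ t₂ :=
      F.ball_subset_ball x (min_le_right _ _) hm (min_le_right _ _) hy
    by_cases hyx : y = x
    · exact hyx ▸ hxG
    · exact absurd hy' (h₂ x hx y hyx).not_gt
  · push Not at hx
    obtain ⟨a, ha, hxa⟩ := hx
    obtain ⟨G, hG, hGs⟩ := h₁ a ha x hxa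
    exact ⟨G, hG, (F.ball_subset_ball x (min_le_left _ _) hm (min_le_left _ _)).trans hGs⟩
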